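/- There is no function f : ℕ → ℕ with f(m) ≤ m for all m such that every solvable system of m Boolean equations over ℕ has a solution over ℕ with at most f(m) non-zero entries. Concretely, for every m ≥ 6 there is a system of m Boolean equations in m+1 variables whose unique solution over ℕ has m+1 non-zero entries. -/

import Mathlib

theorem witness_system (m : ℕ) (hm : 6 ≤ m) :
    ∃ (A : Matrix (Fin m) (Fin (m + 1)) ℕ) (c : Fin m → ℕ),
      (∀ i j, A i j = 0 ∨ A i j = 1) ∧
      ∀ b : Fin (m + 1) → ℕ, A.mulVec b = c ↔ b = fun _ => 1 := by
  let S : Fin m → Finset (Fin (m + 1)) := fun i =>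
    if h : i.1 + 1 < m then
      {⟨i.1, by omega⟩, ⟨i.1 + 1, by omega⟩, ⟨i.1 + 2, by omega⟩}
    else {⟨0, by omega⟩, ⟨1, by omega⟩, ⟨3, by omega⟩, ⟨6, by omega⟩}
  let A : Matrix (Fin m) (Fin (m + 1)) ℕ := fun i j => if j ∈ S i then 1 else 0
  have hA : ∀ (b : Fin (m + 1) → ℕ) i, A.mulVec b i = ∑ j ∈ S i, b j := by
    intro b i
    simp [Matrix.mulVec, dotProduct, A]
  have hA1 : ∀ (b : Fin (m + 1) → ℕ) (i : Fin m) (h : i.1 + 1 < m), A.mulVec b i =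
      b ⟨i.1, by omega⟩ + (b ⟨i.1 + 1, by omega⟩ + b ⟨i.1 + 2, by omega⟩) := by
    intro b i h
    rw [hA]
    simp only [S, h, dif_pos]
    rw [Finset.sum_insert (by simp), Finset.sum_insert (by simp), Finset.sum_singleton]
  have hA2 : ∀ (b : Fin (m + 1) → ℕ) (i : Fin m) (_ : ¬ i.1 + 1 < m), A.mulVec b i =
      b ⟨0, by omega⟩ + (b ⟨1, by omega⟩ + (b ⟨3, by omega⟩ + b ⟨6, by omega⟩)) := by
    intro b i h
    rw [hA]
    simp only [S, h, dif_neg, not_false_eq_true]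
    rw [Finset.sum_insert (by simp), Finset.sum_insert (by simp),
      Finset.sum_insert (by simp), Finset.sum_singleton]
  refine ⟨A, fun i => if i.1 + 1 < m then 3 else 4, ?_, ?_⟩
  · intro i j
    simp only [A]
    split_ifs <;> simp
  intro b
  constructor
  · intro hb
    have e : ∀ (i : ℕ) (h : i + 1 < m),
        b ⟨i, by omega⟩ + (b ⟨i + 1, by omega⟩ + b ⟨i + 2, by omega⟩) = 3 := by
      intro i h
      have := congrFun hb ⟨i, by omega⟩
      rw [hA1 b ⟨i, by omega⟩ h] at this
      simpa [h] using this
    have l : b ⟨0, by omega⟩ + (b ⟨1, by omega⟩ + (b ⟨3, by omega⟩ + b ⟨6, by omega⟩)) = 4 := by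
      have := congrFun hb ⟨m - 1, by omega⟩
      have hn : ¬ (m - 1 + 1 < m) := by omega
      rw [hA2 b ⟨m - 1, by omega⟩ hn] at this
      simpa [hn] using this
    have e0 := e 0 (by omega)
    have e1 := e 1 (by omega)
    have e2 := e 2 (by omega)
    have e3 := e 3 (by omega)
    have e4 := e 4 (by omega)
    simp only [Nat.reduceAdd] at e0 e1 e2 e3 e4
    have key : ∀ (k : ℕ) (h : k < m + 1), b ⟨k, h⟩ = 1 := by
      intro k
      induction k using Nat.strong_induction_on with
      | _ k ih =>
        intro h
        match k, ih, h with
        | 0, _, _ => omega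
        | 1, _, _ => omega
        | n + 2, ih, h =>
          by_cases hn : n = 0
          · subst hn
            simp only [Nat.reduceAdd]
            omega
          have a := ih n (by omega) (by omega)
          have a2 := ih (n + 1) (by omega) (by omega)
          have := e n (by omega)
          omega
    funext j
    exact key j.1 j.2
  · rintro rfl
    funext i
    by_cases h : i.1 + 1 < m
    · rw [hA1 _ i h]
      simp [h]
    · rw [hA2 _ i h]
      simp [h]

theorem no_linear_sparsity_bound_over_nat :
    (¬ ∃ f : ℕ → ℕ, (∀ m, f m ≤ m) ∧
      ∀ (m L : ℕ) (A : Matrix (Fin m) (Fin L) ℕ) (c : Fin m → ℕ),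
        (∀ i j, A i j = 0 ∨ A i j = 1) →
        (∃ b : Fin L → ℕ, A.mulVec b = c) →
        ∃ b : Fin L → ℕ, A.mulVec b = c ∧
          (Finset.univ.filter (fun j => b j ≠ 0)).card ≤ f m) ∧
    ∀ m : ℕ, 6 ≤ m →
      ∃ (A : Matrix (Fin m) (Fin (m + 1)) ℕ) (c : Fin m → ℕ),
        (∀ i j, A i j = 0 ∨ A i j = 1) ∧
        (∃! b : Fin (m + 1) → ℕ, A.mulVec b = c) ∧
        (∀ b : Fin (m + 1) → ℕ, A.mulVec b = c →
          (Finset.univ.filter (fun j => b j ≠ 0)).card = m + 1) := by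
  have H : ∀ m : ℕ, 6 ≤ m →
      ∃ (A : Matrix (Fin m) (Fin (m + 1)) ℕ) (c : Fin m → ℕ),
        (∀ i j, A i j = 0 ∨ A i j = 1) ∧
        (∃! b : Fin (m + 1) → ℕ, A.mulVec b = c) ∧
        (∀ b : Fin (m + 1) → ℕ, A.mulVec b = c →
          (Finset.univ.filter (fun j => b j ≠ 0)).card = m + 1) := by
    intro m hm
    obtain ⟨A, c, h01, hb⟩ := witness_system m hm
    refine ⟨A, c, h01, ⟨fun _ => 1, (hb _).2 rfl, fun b h => (hb b).1 h⟩, ?_⟩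
    intro b h
    rw [(hb b).1 h]
    simp
  refine ⟨?_, H⟩
  rintro ⟨f, hf, h⟩
  obtain ⟨A, c, h01, hu, hc⟩ := H 6 le_rfl
  obtain ⟨b, hb, hcard⟩ := h 6 (6 + 1) A c h01 hu.exists
  rw [hc b hb] at hcard
  have h2 := hf 6
  omega
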